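/- arXiv:2108.10822 — 2 statements merged into one kernel-verified Lean document; each statement's English description precedes it below -/
import Mathlib

section
/- (Pointwise form of the reduced fourth-order coefficient, Proposition 4.3.) Let g > 0, k₀ > 0, and χⱼ = (λⱼ, μⱼ) ∈ ℝ², j = 1,…,4, be fixed with χ₁ + χ₂ = χ₃ + χ₄ and χ₁ ≠ χ₃. Substitute k₁ = (k₀,0)+εχ₁, k₂ = (k₀,0)+εχ₂, k₃ = −((k₀,0)+εχ₃), k₄ = −((k₀,0)+εχ₄) into T₁ − (1/2)(I + II + III). Then, as ε → 0⁺, T₁ − (1/2)(I + II + III) = (k₀³/(8π²))·( 1 + (3ε/(4k₀))(λ₁+λ₂+λ₃+λ₄) ) − ε·(k₀²/(8π²))·(λ₁−λ₃)²/‖χ₁−χ₃‖ + O(ε^{3/2}). -/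
open Asymptotics Filter Topology

/-- Euclidean norm on ℝ². -/
noncomputable def norm2 (k : ℝ × ℝ) : ℝ := Real.sqrt (k.1 ^ 2 + k.2 ^ 2)

/-- Euclidean inner product on ℝ². -/
def dot (a b : ℝ × ℝ) : ℝ := a.1 * b.1 + a.2 * b.2

/-- Deep-water dispersion relation ω(k) = √(g‖k‖). -/
noncomputable def omg (g : ℝ) (k : ℝ × ℝ) : ℝ := Real.sqrt (g * norm2 k)

/-- ℓ_a^b = (‖a‖‖b‖ + a·b)/√(‖a‖‖b‖). -/
noncomputable def ell (a b : ℝ × ℝ) : ℝ :=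
  (norm2 a * norm2 b + dot a b) / Real.sqrt (norm2 a * norm2 b)

/-- The quartic interaction coefficient T₁. -/
noncomputable def T1 (k₁ k₂ k₃ k₄ : ℝ × ℝ) : ℝ :=
  (norm2 k₁ * norm2 k₂ * norm2 k₃ * norm2 k₄) ^ ((1 : ℝ) / 4) / (64 * Real.pi ^ 2) *
    (Real.sqrt (norm2 k₁ * norm2 k₂) * (norm2 k₁ + norm2 k₂ - 2 * norm2 (k₂ - k₃))
      + Real.sqrt (norm2 k₃ * norm2 k₄) * (norm2 k₃ + norm2 k₄ - 2 * norm2 (k₁ - k₄))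
      - 2 * Real.sqrt (norm2 k₁ * norm2 k₄) *
        (2 * norm2 k₁ + 2 * norm2 k₄ - norm2 (k₁ + k₂) - norm2 (k₃ + k₄)
          - norm2 (k₁ - k₃) - norm2 (k₂ - k₄)))

/-- The coefficient I of Proposition 4.3. -/
noncomputable def coefI (g : ℝ) (k₁ k₂ k₃ k₄ : ℝ × ℝ) : ℝ :=
  Real.sqrt g / (128 * Real.pi ^ 2) *
    (norm2 k₁ * norm2 k₂ * norm2 k₃ * norm2 k₄ * norm2 (k₁ + k₂) * norm2 (k₃ + k₄)) ^
      ((1 : ℝ) / 4) *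
    (ell k₁ k₂ + ell (k₁ + k₂) (-k₁) + ell (k₁ + k₂) (-k₂)) *
    (ell k₃ k₄ + ell (k₃ + k₄) (-k₃) + ell (k₃ + k₄) (-k₄)) *
    (1 / (omg g k₁ + omg g k₂ + omg g (k₁ + k₂))
      + 1 / (omg g k₃ + omg g k₄ + omg g (k₃ + k₄)))

/-- The coefficient II of Proposition 4.3. -/
noncomputable def coefII (g : ℝ) (k₁ k₂ k₃ k₄ : ℝ × ℝ) : ℝ :=
  Real.sqrt g / (32 * Real.pi ^ 2) *
    (norm2 k₁ * norm2 k₂ * norm2 k₃ * norm2 k₄ * norm2 (k₁ + k₃) * norm2 (k₂ + k₄)) ^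
      ((1 : ℝ) / 4) *
    (ell k₁ k₃ + ell (k₁ + k₃) (-k₃) - ell (k₁ + k₃) (-k₁)) *
    (ell k₄ k₂ + ell (k₂ + k₄) (-k₂) - ell (k₂ + k₄) (-k₄)) *
    (1 / (omg g k₁ + omg g (k₁ + k₃) - omg g k₃)
      + 1 / (omg g k₄ + omg g (k₂ + k₄) - omg g k₂))

/-- The coefficient III of Proposition 4.3. -/
noncomputable def coefIII (g : ℝ) (k₁ k₂ k₃ k₄ : ℝ × ℝ) : ℝ :=
  -(Real.sqrt g / (128 * Real.pi ^ 2)) *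
    (norm2 k₁ * norm2 k₂ * norm2 k₃ * norm2 k₄ * norm2 (k₁ + k₂) * norm2 (k₃ + k₄)) ^
      ((1 : ℝ) / 4) *
    (ell (k₁ + k₂) (-k₁) + ell (k₁ + k₂) (-k₂) - ell k₁ k₂) *
    (ell (k₃ + k₄) (-k₃) + ell (k₃ + k₄) (-k₄) - ell k₃ k₄) *
    (1 / (omg g k₁ + omg g k₂ - omg g (k₁ + k₂))
      + 1 / (omg g k₃ + omg g k₄ - omg g (k₃ + k₄)))

/-! ### First-order expansions at `0⁺` -/

/-- `f ε = a + b ε + O(ε²)` as `ε → 0⁺`. -/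
def HasJet (f : ℝ → ℝ) (a b : ℝ) : Prop :=
  (fun ε => f ε - (a + b * ε)) =O[𝓝[>] (0 : ℝ)] fun ε => ε ^ 2

namespace HasJet

variable {f h : ℝ → ℝ} {a b c d : ℝ}

theorem congr (hf : HasJet f a b) (hac : a = c) (hbd : b = d) : HasJet f c d := by
  subst hac hbd; exact hf

theorem congr_fun (hf : HasJet f a b) (hfh : ∀ ε, h ε = f ε) : HasJet h a b := by
  rwa [show h = f from funext hfh]

theorem affine (a b : ℝ) : HasJet (fun ε => a + b * ε) a b := by
  simpa [HasJet] using isBigO_zero _ _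

theorem const (a : ℝ) : HasJet (fun _ => a) a 0 := by
  simpa [HasJet] using isBigO_zero _ _

theorem tendsto_affine (a b : ℝ) : Tendsto (fun ε : ℝ => a + b * ε) (𝓝[>] 0) (𝓝 a) := by
  have : Continuous fun ε : ℝ => a + b * ε := by fun_prop
  simpa using (this.tendsto 0).mono_left nhdsWithin_le_nhds

theorem tendsto (hf : HasJet f a b) : Tendsto f (𝓝[>] 0) (𝓝 a) := by
  have hsq : Tendsto (fun ε : ℝ => ε ^ 2) (𝓝[>] 0) (𝓝 0) := by
    have : Continuous fun ε : ℝ => ε ^ 2 := by fun_prop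
    simpa using (this.tendsto 0).mono_left nhdsWithin_le_nhds
  simpa using (IsBigO.trans_tendsto hf hsq).add (tendsto_affine a b)

theorem add (hf : HasJet f a b) (hh : HasJet h c d) :
    HasJet (fun ε => f ε + h ε) (a + c) (b + d) :=
  (IsBigO.add hf hh).congr_left fun ε => by ring

theorem sub (hf : HasJet f a b) (hh : HasJet h c d) :
    HasJet (fun ε => f ε - h ε) (a - c) (b - d) :=
  (IsBigO.sub hf hh).congr_left fun ε => by ring

theorem mul (hf : HasJet f a b) (hh : HasJet h c d) :
    HasJet (fun ε => f ε * h ε) (a * c) (a * d + b * c) := by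
  have h1 : (fun ε => (f ε - (a + b * ε)) * h ε) =O[𝓝[>] (0 : ℝ)] fun ε => ε ^ 2 := by
    simpa using IsBigO.mul hf (hh.tendsto.isBigO_one ℝ)
  have h2 : (fun ε => (h ε - (c + d * ε)) * (a + b * ε)) =O[𝓝[>] (0 : ℝ)] fun ε => ε ^ 2 := by
    simpa using IsBigO.mul hh ((tendsto_affine a b).isBigO_one ℝ)
  have h3 : (fun ε : ℝ => b * d * ε ^ 2) =O[𝓝[>] (0 : ℝ)] fun ε => ε ^ 2 :=
    (isBigO_refl _ _).const_mul_left _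
  exact ((h1.add h2).add h3).congr_left fun ε => by ring

theorem const_mul (k : ℝ) (hf : HasJet f a b) : HasJet (fun ε => k * f ε) (k * a) (k * b) :=
  ((const k).mul hf).congr rfl (by ring)

theorem inv (hf : HasJet f a b) (ha : a ≠ 0) :
    HasJet (fun ε => (f ε)⁻¹) a⁻¹ (-b / a ^ 2) := by
  have h1 : (fun ε => (f ε - (a + b * ε)) * (a + -b * ε)) =O[𝓝[>] (0 : ℝ)] fun ε => ε ^ 2 := by
    simpa using IsBigO.mul hf ((tendsto_affine a (-b)).isBigO_one ℝ)
  have h2 : (fun ε : ℝ => b ^ 2 * ε ^ 2) =O[𝓝[>] (0 : ℝ)] fun ε => ε ^ 2 :=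
    (isBigO_refl _ _).const_mul_left _
  have h3 : (fun ε => (b ^ 2 * ε ^ 2 - (f ε - (a + b * ε)) * (a + -b * ε)) * (a ^ 2 * f ε)⁻¹)
      =O[𝓝[>] (0 : ℝ)] fun ε => ε ^ 2 := by
    simpa using (h2.sub h1).mul
      (((hf.tendsto.const_mul (a ^ 2)).inv₀ (mul_ne_zero (pow_ne_zero 2 ha) ha)).isBigO_one ℝ)
  refine h3.congr' ?_ EventuallyEq.rfl
  filter_upwards [hf.tendsto.eventually_ne ha] with ε hε
  field_simp
  ring

theorem sqrt (hf : HasJet f (a ^ 2) (2 * a * b)) (ha : 0 < a) :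
    HasJet (fun ε => √(f ε)) a b := by
  have h1 : (fun ε : ℝ => b ^ 2 * ε ^ 2) =O[𝓝[>] (0 : ℝ)] fun ε => ε ^ 2 :=
    (isBigO_refl _ _).const_mul_left _
  have hlim : Tendsto (fun ε => √(f ε) + (a + b * ε)) (𝓝[>] 0) (𝓝 (2 * a)) := by
    have := hf.tendsto.sqrt.add (tendsto_affine a b)
    rwa [Real.sqrt_sq ha.le, ← two_mul] at this
  have h2 : (fun ε => (f ε - (a ^ 2 + 2 * a * b * ε) - b ^ 2 * ε ^ 2) *
      (√(f ε) + (a + b * ε))⁻¹) =O[𝓝[>] (0 : ℝ)] fun ε => ε ^ 2 := by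
    simpa using (IsBigO.sub hf h1).mul ((hlim.inv₀ (by positivity)).isBigO_one ℝ)
  refine h2.congr' ?_ EventuallyEq.rfl
  filter_upwards [hlim.eventually_ne (by positivity),
    hf.tendsto.eventually_const_lt (pow_pos ha 2)] with ε hε hpos
  have hs := Real.sq_sqrt hpos.le
  field_simp
  linear_combination -hs

end HasJet

/-! ### Leading-order expansions at `0⁺` -/

/-- `f ε = a + O(√ε)` as `ε → 0⁺`. -/
def HasLead (f : ℝ → ℝ) (a : ℝ) : Prop :=
  (fun ε => f ε - a) =O[𝓝[>] (0 : ℝ)] fun ε => √ε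

theorem isBigO_id_sqrt : (fun ε : ℝ => ε) =O[𝓝[>] (0 : ℝ)] fun ε => √ε := by
  have h : Tendsto (fun ε : ℝ => √ε) (𝓝[>] 0) (𝓝 0) := by
    simpa using (Real.continuous_sqrt.tendsto 0).mono_left nhdsWithin_le_nhds
  have h2 : (fun ε : ℝ => √ε * √ε) =O[𝓝[>] (0 : ℝ)] fun ε => √ε := by
    simpa using (h.isBigO_one ℝ).mul (isBigO_refl (fun ε : ℝ => √ε) (𝓝[>] 0))
  refine h2.congr' ?_ EventuallyEq.rfl
  filter_upwards [self_mem_nhdsWithin] with ε hε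
  exact Real.mul_self_sqrt (le_of_lt hε)

theorem HasJet.isBigO_id {f : ℝ → ℝ} {a b : ℝ} (hf : HasJet f a b) :
    (fun ε => f ε - a) =O[𝓝[>] (0 : ℝ)] fun ε => ε := by
  have hsq : (fun ε : ℝ => ε ^ 2) =O[𝓝[>] (0 : ℝ)] fun ε => ε := by
    simpa [pow_two] using ((HasJet.affine 0 1).tendsto.isBigO_one ℝ).mul
      (isBigO_refl (fun ε : ℝ => ε) (𝓝[>] 0))
  have hlin : (fun ε : ℝ => b * ε) =O[𝓝[>] (0 : ℝ)] fun ε => ε :=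
    (isBigO_refl _ _).const_mul_left _
  exact ((IsBigO.trans hf hsq).add hlin).congr_left fun ε => by ring

theorem HasJet.hasLead {f : ℝ → ℝ} {a b : ℝ} (hf : HasJet f a b) : HasLead f a :=
  hf.isBigO_id.trans isBigO_id_sqrt

theorem HasJet.hasLead_div_sqrt {f : ℝ → ℝ} {b : ℝ} (hf : HasJet f 0 b) :
    HasLead (fun ε => f ε / √ε) 0 := by
  have h := hf.isBigO_id.mul (isBigO_refl (fun ε : ℝ => (√ε)⁻¹) (𝓝[>] 0))
  refine h.congr' (Eventually.of_forall fun ε => by simp [div_eq_mul_inv]) ?_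
  filter_upwards [self_mem_nhdsWithin] with ε hε
  rw [← div_eq_mul_inv, Real.div_sqrt]

namespace HasLead

variable {f h : ℝ → ℝ} {a c : ℝ}

theorem congr (hf : HasLead f a) (hac : a = c) : HasLead f c := hac ▸ hf

theorem congr_fun (hf : HasLead f a) (hfh : ∀ ε, 0 < ε → h ε = f ε) : HasLead h a := by
  refine IsBigO.congr' hf ?_ EventuallyEq.rfl
  filter_upwards [self_mem_nhdsWithin] with ε hε
  rw [hfh ε hε]

theorem tendsto (hf : HasLead f a) : Tendsto f (𝓝[>] 0) (𝓝 a) := by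
  have h : Tendsto (fun ε : ℝ => √ε) (𝓝[>] 0) (𝓝 0) := by
    simpa using (Real.continuous_sqrt.tendsto 0).mono_left nhdsWithin_le_nhds
  simpa using (IsBigO.trans_tendsto hf h).add_const a

theorem const (a : ℝ) : HasLead (fun _ => a) a := (HasJet.const a).hasLead

theorem add (hf : HasLead f a) (hh : HasLead h c) : HasLead (fun ε => f ε + h ε) (a + c) :=
  (IsBigO.add hf hh).congr_left fun ε => by ring

theorem sub (hf : HasLead f a) (hh : HasLead h c) : HasLead (fun ε => f ε - h ε) (a - c) :=
  (IsBigO.sub hf hh).congr_left fun ε => by ring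

theorem mul (hf : HasLead f a) (hh : HasLead h c) : HasLead (fun ε => f ε * h ε) (a * c) := by
  have h1 : (fun ε => (f ε - a) * h ε) =O[𝓝[>] (0 : ℝ)] fun ε => √ε := by
    simpa using IsBigO.mul hf (hh.tendsto.isBigO_one ℝ)
  exact (h1.add (IsBigO.const_mul_left hh a)).congr_left fun ε => by ring

theorem inv (hf : HasLead f a) (ha : a ≠ 0) : HasLead (fun ε => (f ε)⁻¹) a⁻¹ := by
  have h1 : (fun ε => (f ε - a) * -(a * f ε)⁻¹) =O[𝓝[>] (0 : ℝ)] fun ε => √ε := by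
    simpa using IsBigO.mul hf
      (((hf.tendsto.const_mul a).inv₀ (mul_ne_zero ha ha)).neg.isBigO_one ℝ)
  refine h1.congr' ?_ EventuallyEq.rfl
  filter_upwards [hf.tendsto.eventually_ne ha] with ε hε
  field_simp
  ring

end HasLead

/-! ### Elementary identities -/

theorem norm2_neg (k : ℝ × ℝ) : norm2 (-k) = norm2 k := by simp [norm2]

theorem norm2_nonneg (k : ℝ × ℝ) : 0 ≤ norm2 k := Real.sqrt_nonneg _

theorem norm2_pos {k : ℝ × ℝ} (hk : k ≠ 0) : 0 < norm2 k := by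
  refine Real.sqrt_pos.2 ?_
  by_contra! hle
  have h1 : k.1 ^ 2 = 0 := by nlinarith [sq_nonneg k.1, sq_nonneg k.2]
  have h2 : k.2 ^ 2 = 0 := by nlinarith [sq_nonneg k.1, sq_nonneg k.2]
  exact hk (Prod.ext (by simpa using h1) (by simpa using h2))

theorem norm2_smul {ε : ℝ} (hε : 0 ≤ ε) (k : ℝ × ℝ) : norm2 (ε • k) = ε * norm2 k := by
  simp only [norm2, Prod.smul_fst, Prod.smul_snd, smul_eq_mul]
  rw [show (ε * k.1) ^ 2 + (ε * k.2) ^ 2 = ε ^ 2 * (k.1 ^ 2 + k.2 ^ 2) by ring,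
    Real.sqrt_mul (sq_nonneg ε), Real.sqrt_sq hε]

theorem ell_neg_neg (a b : ℝ × ℝ) : ell (-a) (-b) = ell a b := by
  simp [ell, norm2_neg, dot]

theorem omg_neg (g : ℝ) (k : ℝ × ℝ) : omg g (-k) = omg g k := by simp [omg, norm2_neg]

theorem omg_eq {g : ℝ} (hg : 0 ≤ g) (k : ℝ × ℝ) : omg g k = √g * √(norm2 k) :=
  Real.sqrt_mul hg _

theorem rpow_quarter_eq {x : ℝ} (hx : 0 ≤ x) : x ^ ((1 : ℝ) / 4) = √(√x) := by
  rw [Real.sqrt_eq_rpow, Real.sqrt_eq_rpow, ← Real.rpow_mul hx]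
  norm_num

theorem rpow_quarter_mul_sq {x y : ℝ} (hx : 0 ≤ x) (hy : 0 ≤ y) :
    (x * y * y) ^ ((1 : ℝ) / 4) = √(√x) * √y := by
  rw [rpow_quarter_eq (by positivity), mul_assoc, Real.sqrt_mul hx, Real.sqrt_mul_self hy,
    Real.sqrt_mul (Real.sqrt_nonneg x)]

/-! ### Perturbations of a carrier wave vector -/

/-- The wave vector `(k, 0) + ε χ`. -/
def wave (k : ℝ) (χ : ℝ × ℝ) (ε : ℝ) : ℝ × ℝ := (k, 0) + ε • χ

theorem wave_add_wave (k l : ℝ) (χ ψ : ℝ × ℝ) (ε : ℝ) :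
    wave k χ ε + wave l ψ ε = wave (k + l) (χ + ψ) ε := by
  ext
  · simp [wave]
    ring
  · simp [wave]

theorem wave_sub_neg_wave (k l : ℝ) (χ ψ : ℝ × ℝ) (ε : ℝ) :
    wave k χ ε - -wave l ψ ε = wave (k + l) (χ + ψ) ε := by
  rw [sub_neg_eq_add, wave_add_wave]

theorem wave_add_neg_wave (k : ℝ) (χ ψ : ℝ × ℝ) (ε : ℝ) :
    wave k χ ε + -wave k ψ ε = ε • (χ - ψ) := by
  ext <;> simp [wave] <;> ring

theorem neg_wave_add_neg_wave (k l : ℝ) (χ ψ : ℝ × ℝ) (ε : ℝ) :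
    -wave k χ ε + -wave l ψ ε = -wave (k + l) (χ + ψ) ε := by
  rw [← wave_add_wave, neg_add]

section Expansions

variable {k l : ℝ} (χ ψ : ℝ × ℝ)

theorem hasJet_norm2 (hk : 0 < k) : HasJet (fun ε => norm2 (wave k χ ε)) k χ.1 := by
  have h1 := HasJet.affine k χ.1
  have h2 := HasJet.affine 0 χ.2
  refine HasJet.sqrt (HasJet.congr_fun (((h1.mul h1).add (h2.mul h2)).congr ?_ ?_) ?_) hk
  · ring
  · ring
  · intro ε; simp [wave]; ring

theorem hasJet_sqrt_norm2 {c : ℝ} (hc : 0 < c) :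
    HasJet (fun ε => √(norm2 (wave (c ^ 2) χ ε))) c (χ.1 / (2 * c)) :=
  ((hasJet_norm2 χ (pow_pos hc 2)).congr rfl (by field_simp)).sqrt hc

theorem hasJet_dot : HasJet (fun ε => dot (wave k χ ε) (wave l ψ ε))
    (k * l) (k * ψ.1 + χ.1 * l) := by
  have h1 := (HasJet.affine k χ.1).mul (HasJet.affine l ψ.1)
  have h2 := (HasJet.affine 0 χ.2).mul (HasJet.affine 0 ψ.2)
  refine HasJet.congr_fun ((h1.add h2).congr ?_ ?_) ?_
  · ring
  · ring
  · intro ε; simp [wave, dot]; ring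

theorem hasJet_sqrt_norm2_mul_norm2 {c d : ℝ} (hc : 0 < c) (hd : 0 < d) :
    HasJet (fun ε => √(norm2 (wave (c ^ 2) χ ε) * norm2 (wave (d ^ 2) ψ ε)))
      (c * d) (c * (ψ.1 / (2 * d)) + χ.1 / (2 * c) * d) :=
  ((hasJet_sqrt_norm2 χ hc).mul (hasJet_sqrt_norm2 ψ hd)).congr_fun fun _ =>
    Real.sqrt_mul (norm2_nonneg _) _

theorem hasJet_ell {c : ℝ} (hc : 0 < c) :
    HasJet (fun ε => ell (wave (c ^ 2) χ ε) (wave (c ^ 2) ψ ε)) (2 * c ^ 2) (χ.1 + ψ.1) := by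
  have hc2 : 0 < c ^ 2 := pow_pos hc 2
  have hs := hasJet_sqrt_norm2_mul_norm2 χ ψ hc hc
  refine HasJet.congr (((hasJet_norm2 χ hc2).mul (hasJet_norm2 ψ hc2)).add
    (hasJet_dot χ ψ) |>.mul (hs.inv (by positivity))) ?_ ?_
  · field_simp; ring
  · field_simp; ring

theorem hasJet_ell_neg (hk : 0 < k) (hl : 0 < l) :
    HasJet (fun ε => ell (wave k χ ε) (-wave l ψ ε)) 0 0 := by
  obtain ⟨c, hc, rfl⟩ : ∃ c, 0 < c ∧ c ^ 2 = k := ⟨√k, Real.sqrt_pos.2 hk, Real.sq_sqrt hk.le⟩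
  obtain ⟨d, hd, rfl⟩ : ∃ d, 0 < d ∧ d ^ 2 = l := ⟨√l, Real.sqrt_pos.2 hl, Real.sq_sqrt hl.le⟩
  have hs := hasJet_sqrt_norm2_mul_norm2 χ ψ hc hd
  refine HasJet.congr_fun (HasJet.congr (((hasJet_norm2 χ hk).mul (hasJet_norm2 ψ hl)).sub
    (hasJet_dot (k := c ^ 2) (l := d ^ 2) χ ψ) |>.mul (hs.inv (by positivity))) ?_ ?_) ?_
  · ring
  · ring
  · intro ε
    simp only [ell, norm2_neg, div_eq_mul_inv]
    simp [dot, sub_eq_add_neg, add_comm]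

end Expansions

/-- The fourth root of the product of the four wave numbers. -/
theorem hasJet_sqrt_sqrt_norm2 {c : ℝ} (hc : 0 < c) (χ₁ χ₂ χ₃ χ₄ : ℝ × ℝ) :
    HasJet (fun ε => √(√(norm2 (wave (c ^ 2) χ₁ ε) * norm2 (wave (c ^ 2) χ₂ ε) *
      norm2 (wave (c ^ 2) χ₃ ε) * norm2 (wave (c ^ 2) χ₄ ε))))
      (c ^ 2) ((χ₁.1 + χ₂.1 + χ₃.1 + χ₄.1) / 4) := by
  have hs := (hasJet_sqrt_norm2_mul_norm2 χ₁ χ₂ hc hc).mul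
    (hasJet_sqrt_norm2_mul_norm2 χ₃ χ₄ hc hc)
  refine HasJet.sqrt (HasJet.congr_fun (hs.congr ?_ ?_) fun ε => ?_) (pow_pos hc 2)
  · ring
  · field_simp; ring
  · rw [mul_assoc (norm2 _ * norm2 _), Real.sqrt_mul (mul_nonneg (norm2_nonneg _) (norm2_nonneg _))]

theorem hasJet_T1 {c : ℝ} (hc : 0 < c) {χ₁ χ₂ χ₃ χ₄ : ℝ × ℝ} (hχ : χ₁ + χ₂ = χ₃ + χ₄) :
    HasJet (fun ε => T1 (wave (c ^ 2) χ₁ ε) (wave (c ^ 2) χ₂ ε)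
      (-wave (c ^ 2) χ₃ ε) (-wave (c ^ 2) χ₄ ε))
      (c ^ 6 / (16 * Real.pi ^ 2)) (3 * c ^ 4 * (χ₁.1 + χ₂.1) / (32 * Real.pi ^ 2)) := by
  have h4 : χ₄.1 = χ₁.1 + χ₂.1 - χ₃.1 := by
    have := congrArg Prod.fst hχ
    simp only [Prod.fst_add] at this
    linarith
  have hc2 : 0 < c ^ 2 := pow_pos hc 2
  have hcc : 0 < c ^ 2 + c ^ 2 := by positivity
  have hQ := hasJet_sqrt_sqrt_norm2 hc χ₁ χ₂ χ₃ χ₄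
  have n (χ) := hasJet_norm2 χ hc2
  have m (χ) := hasJet_norm2 χ hcc
  have s (χ ψ) := hasJet_sqrt_norm2_mul_norm2 χ ψ hc hc
  have hb := (((s χ₁ χ₂).mul (((n χ₁).add (n χ₂)).sub ((m (χ₂ + χ₃)).const_mul 2))).add
      ((s χ₃ χ₄).mul (((n χ₃).add (n χ₄)).sub ((m (χ₁ + χ₄)).const_mul 2)))).sub
      (((s χ₁ χ₄).const_mul 2).mul (((((((n χ₁).const_mul 2).add ((n χ₄).const_mul 2)).sub
        (m (χ₁ + χ₂))).sub (m (χ₃ + χ₄))).sub (m (χ₁ + χ₃))).sub (m (χ₂ + χ₄))))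
  refine HasJet.congr_fun ((((hQ.mul (HasJet.const (64 * Real.pi ^ 2)⁻¹)).mul hb)).congr ?_ ?_) ?_
  · field_simp
    ring
  · simp only [Prod.fst_add, h4]
    field_simp
    ring
  · intro ε
    simp only [T1, norm2_neg, wave_sub_neg_wave, wave_add_wave, neg_wave_add_neg_wave]
    rw [rpow_quarter_eq (mul_nonneg (mul_nonneg (mul_nonneg (norm2_nonneg _) (norm2_nonneg _))
      (norm2_nonneg _)) (norm2_nonneg _))]
    ring

/-- Expansion of the sum and difference resonance denominators of `coefI` and `coefIII`. -/
theorem hasJet_denominator {g c : ℝ} (hg : 0 < g) (hc : 0 < c) {s r : ℝ} (hs : s ^ 2 = 1)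
    (hr : r ^ 2 = 2) (hr0 : 0 < r) (χ ψ : ℝ × ℝ) :
    HasJet (fun ε => √g * (omg g (wave (c ^ 2) χ ε) + omg g (wave (c ^ 2) ψ ε) +
        s * omg g (wave (c ^ 2 + c ^ 2) (χ + ψ) ε))⁻¹)
      ((2 - s * r) / (2 * c)) (-(χ.1 + ψ.1) * (2 - s * r) / (8 * c ^ 3)) := by
  have hrc : 0 < r * c := mul_pos hr0 hc
  have hprod : (2 - s * r) * (2 + s * r) = 2 := by
    linear_combination -r ^ 2 * hs - hr
  have hne : 2 + s * r ≠ 0 := by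
    intro h
    norm_num [h] at hprod
  have h2 : (r * c) ^ 2 = c ^ 2 + c ^ 2 := by rw [mul_pow, hr]; ring
  have h3 := hasJet_sqrt_norm2 (χ + ψ) hrc
  rw [h2] at h3
  have hD := (((hasJet_sqrt_norm2 χ hc).add (hasJet_sqrt_norm2 ψ hc)).add (h3.const_mul s))
  have hD0 : c + c + s * (r * c) = c * (2 + s * r) := by ring
  have hgne : √g ≠ 0 := (Real.sqrt_pos.2 hg).ne'
  refine HasJet.congr_fun ((hD.inv (by rw [hD0]; positivity)).congr ?_ ?_) ?_
  · rw [hD0, inv_eq_one_div, div_eq_div_iff (by positivity) (by positivity)]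
    linear_combination -c * hprod
  · rw [hD0, Prod.fst_add, show -(χ.1 + ψ.1) * (2 - s * r) / (8 * c ^ 3) =
      -(χ.1 + ψ.1) / (4 * c ^ 3 * (2 + s * r)) by
        rw [div_eq_div_iff (by positivity) (by positivity)]
        linear_combination -4 * c ^ 3 * (χ.1 + ψ.1) * hprod]
    field_simp
    linear_combination (2 * (χ.1 + ψ.1) * s) * hr
  · intro ε
    simp only [omg_eq hg.le]
    rw [show √g * √(norm2 (wave (c ^ 2) χ ε)) + √g * √(norm2 (wave (c ^ 2) ψ ε)) +
      s * (√g * √(norm2 (wave (c ^ 2 + c ^ 2) (χ + ψ) ε))) =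
      √g * (√(norm2 (wave (c ^ 2) χ ε)) + √(norm2 (wave (c ^ 2) ψ ε)) +
      s * √(norm2 (wave (c ^ 2 + c ^ 2) (χ + ψ) ε))) by ring, mul_inv, mul_inv_cancel_left₀ hgne]

/-- The common prefactor of `coefI` and `coefIII`. -/
theorem hasJet_prefactor {c r : ℝ} (hc : 0 < c) (hr : r ^ 2 = 2) (hr0 : 0 < r)
    {χ₁ χ₂ χ₃ χ₄ : ℝ × ℝ} (hχ : χ₁ + χ₂ = χ₃ + χ₄) :
    HasJet (fun ε => (norm2 (wave (c ^ 2) χ₁ ε) * norm2 (wave (c ^ 2) χ₂ ε) *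
      norm2 (wave (c ^ 2) χ₃ ε) * norm2 (wave (c ^ 2) χ₄ ε) *
      norm2 (wave (c ^ 2 + c ^ 2) (χ₁ + χ₂) ε) * norm2 (wave (c ^ 2 + c ^ 2) (χ₃ + χ₄) ε)) ^
        ((1 : ℝ) / 4)) (r * c ^ 3) (3 * r * c * (χ₁.1 + χ₂.1) / 4) := by
  have h4 : χ₃.1 + χ₄.1 = χ₁.1 + χ₂.1 := (congrArg Prod.fst hχ).symm
  have h2 : (r * c) ^ 2 = c ^ 2 + c ^ 2 := by rw [mul_pow, hr]; ring
  have h3 := hasJet_sqrt_norm2 (χ₁ + χ₂) (mul_pos hr0 hc)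
  rw [h2] at h3
  refine HasJet.congr_fun (((hasJet_sqrt_sqrt_norm2 hc χ₁ χ₂ χ₃ χ₄).mul h3).congr ?_ ?_) ?_
  · ring
  · rw [Prod.fst_add, add_assoc (χ₁.1 + χ₂.1), h4]
    field_simp
    linear_combination (-2 * (χ₁.1 + χ₂.1)) * hr
  · intro ε
    rw [← hχ, rpow_quarter_mul_sq (mul_nonneg (mul_nonneg (mul_nonneg (norm2_nonneg _)
      (norm2_nonneg _)) (norm2_nonneg _)) (norm2_nonneg _)) (norm2_nonneg _)]

theorem hasJet_coefI_add_coefIII {g c : ℝ} (hg : 0 < g) (hc : 0 < c) {χ₁ χ₂ χ₃ χ₄ : ℝ × ℝ}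
    (hχ : χ₁ + χ₂ = χ₃ + χ₄) :
    HasJet (fun ε => coefI g (wave (c ^ 2) χ₁ ε) (wave (c ^ 2) χ₂ ε)
        (-wave (c ^ 2) χ₃ ε) (-wave (c ^ 2) χ₄ ε) +
      coefIII g (wave (c ^ 2) χ₁ ε) (wave (c ^ 2) χ₂ ε)
        (-wave (c ^ 2) χ₃ ε) (-wave (c ^ 2) χ₄ ε))
      (-c ^ 6 / (8 * Real.pi ^ 2)) (-3 * c ^ 4 * (χ₁.1 + χ₂.1) / (16 * Real.pi ^ 2)) := by
  obtain ⟨r, hr0, hr⟩ : ∃ r : ℝ, 0 < r ∧ r ^ 2 = 2 :=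
    ⟨√2, by positivity, Real.sq_sqrt (by norm_num)⟩
  have h4 : χ₃.1 + χ₄.1 = χ₁.1 + χ₂.1 := (congrArg Prod.fst hχ).symm
  have hc2 : 0 < c ^ 2 := pow_pos hc 2
  have hcc : 0 < c ^ 2 + c ^ 2 := by positivity
  have hP := hasJet_prefactor hc hr hr0 hχ
  have e (χ ψ) := hasJet_ell χ ψ hc
  have z (χ ψ) := hasJet_ell_neg χ ψ hcc hc2
  have d (s : ℝ) (hs : s ^ 2 = 1) (χ ψ) := hasJet_denominator hg hc hs hr hr0 χ ψ
  have hI := ((hP.mul (((e χ₁ χ₂).add (z (χ₁ + χ₂) χ₁)).add (z (χ₁ + χ₂) χ₂))).mul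
    (((e χ₃ χ₄).add (z (χ₃ + χ₄) χ₃)).add (z (χ₃ + χ₄) χ₄))).mul
    ((d 1 (by norm_num) χ₁ χ₂).add (d 1 (by norm_num) χ₃ χ₄))
  have hIII := ((hP.mul (((z (χ₁ + χ₂) χ₁).add (z (χ₁ + χ₂) χ₂)).sub (e χ₁ χ₂))).mul
    (((z (χ₃ + χ₄) χ₃).add (z (χ₃ + χ₄) χ₄)).sub (e χ₃ χ₄))).mul
    ((d (-1) (by norm_num) χ₁ χ₂).add (d (-1) (by norm_num) χ₃ χ₄))
  refine HasJet.congr_fun (((hI.sub hIII).const_mul (128 * Real.pi ^ 2)⁻¹).congr ?_ ?_) ?_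
  · field_simp
    linear_combination (-128 * c ^ 4) * hr
  · rw [h4]
    field_simp
    linear_combination (-12288 * c ^ 4 * (χ₁.1 + χ₂.1)) * hr
  · intro ε
    simp only [coefI, coefIII, norm2_neg, wave_add_wave, neg_wave_add_neg_wave, ell_neg_neg,
      omg_neg, one_div]
    ring

/-! ### The near-resonant coefficient -/

theorem ell_smul {ε : ℝ} (hε : 0 ≤ ε) (χ q : ℝ × ℝ) :
    ell (ε • χ) q = √ε * ((norm2 χ * norm2 q + dot χ q) / (√(norm2 χ) * √(norm2 q))) := by
  have hdot : dot (ε • χ) q = ε * dot χ q := by simp [dot]; ring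
  rw [ell, norm2_smul hε, hdot, mul_assoc, Real.sqrt_mul hε, Real.sqrt_mul (norm2_nonneg χ),
    ← mul_add, mul_div_mul_comm, Real.div_sqrt]

theorem hasLead_ell_smul {c : ℝ} (hc : 0 < c) {χ : ℝ × ℝ} (hχ : χ ≠ 0) (ψ : ℝ × ℝ) (s : ℝ) :
    HasLead (fun ε => (norm2 χ * norm2 (wave (c ^ 2) ψ ε) + s * dot χ (wave (c ^ 2) ψ ε)) /
      (√(norm2 χ) * √(norm2 (wave (c ^ 2) ψ ε)))) (c * (norm2 χ + s * χ.1) / √(norm2 χ)) := by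
  have hN : 0 < √(norm2 χ) := Real.sqrt_pos.2 (norm2_pos hχ)
  have hd : HasJet (fun ε => dot χ (wave (c ^ 2) ψ ε)) (χ.1 * c ^ 2)
      (χ.1 * ψ.1 + χ.2 * ψ.2) :=
    (HasJet.affine _ _).congr_fun fun ε => by simp [dot, wave]; ring
  have h := (((hasJet_norm2 ψ (pow_pos hc 2)).const_mul (norm2 χ)).add (hd.const_mul s)).mul
    (((hasJet_sqrt_norm2 ψ hc).const_mul √(norm2 χ)).inv (by positivity))
  refine h.hasLead.congr ?_
  field_simp

theorem hasLead_ell_combination {c : ℝ} (hc : 0 < c) {χ : ℝ × ℝ} (hχ : χ ≠ 0) (α β : ℝ × ℝ) :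
    HasLead (fun ε => (ell (wave (c ^ 2) α ε) (-wave (c ^ 2) β ε) +
      ell (ε • χ) (wave (c ^ 2) β ε) - ell (ε • χ) (-wave (c ^ 2) α ε)) / √ε)
      (2 * c * χ.1 / √(norm2 χ)) := by
  have hc2 : 0 < c ^ 2 := pow_pos hc 2
  have h := ((hasJet_ell_neg α β hc2 hc2).hasLead_div_sqrt.add (hasLead_ell_smul hc hχ β 1)).sub
    (hasLead_ell_smul hc hχ α (-1))
  refine HasLead.congr_fun (h.congr (by ring)) fun ε hε => ?_
  have hs : √ε ≠ 0 := (Real.sqrt_pos.2 hε).ne'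
  have hdot (q : ℝ × ℝ) : dot χ (-q) = -1 * dot χ q := by simp [dot]; ring
  rw [ell_smul hε.le, ell_smul hε.le, norm2_neg, hdot, sub_div, add_div,
    mul_div_cancel_left₀ _ hs, mul_div_cancel_left₀ _ hs, one_mul]

theorem hasLead_denominator {g c : ℝ} (hg : 0 < g) (hc : 0 < c) {χ : ℝ × ℝ} (hχ : χ ≠ 0)
    (α β : ℝ × ℝ) :
    HasLead (fun ε => √g * √ε * (omg g (wave (c ^ 2) α ε) + omg g (ε • χ) -
      omg g (wave (c ^ 2) β ε))⁻¹) (√(norm2 χ))⁻¹ := by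
  have hN : 0 < √(norm2 χ) := Real.sqrt_pos.2 (norm2_pos hχ)
  have h0 := ((hasJet_sqrt_norm2 α hc).sub (hasJet_sqrt_norm2 β hc)).congr (sub_self c) rfl
  have h := h0.hasLead_div_sqrt.add (HasLead.const √(norm2 χ))
  rw [zero_add] at h
  refine HasLead.congr_fun (h.inv hN.ne') fun ε hε => ?_
  have hs : √ε ≠ 0 := (Real.sqrt_pos.2 hε).ne'
  have hgne : √g ≠ 0 := (Real.sqrt_pos.2 hg).ne'
  simp only [omg_eq hg.le]
  rw [norm2_smul hε.le, Real.sqrt_mul hε.le, div_add' _ _ _ hs, inv_div,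
    show √g * √(norm2 (wave (c ^ 2) α ε)) + √g * (√ε * √(norm2 χ)) -
      √g * √(norm2 (wave (c ^ 2) β ε)) = √g * (√(norm2 (wave (c ^ 2) α ε)) -
      √(norm2 (wave (c ^ 2) β ε)) + √(norm2 χ) * √ε) by ring, mul_inv, div_eq_mul_inv]
  field_simp

theorem coefII_eq {g c ε : ℝ} (hε : 0 < ε) {χ₁ χ₂ χ₃ χ₄ : ℝ × ℝ} (hχ : χ₁ + χ₂ = χ₃ + χ₄) :
    coefII g (wave (c ^ 2) χ₁ ε) (wave (c ^ 2) χ₂ ε) (-wave (c ^ 2) χ₃ ε) (-wave (c ^ 2) χ₄ ε) =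
      ε * ((32 * Real.pi ^ 2)⁻¹ * √(√(norm2 (wave (c ^ 2) χ₁ ε) * norm2 (wave (c ^ 2) χ₂ ε) *
        norm2 (wave (c ^ 2) χ₃ ε) * norm2 (wave (c ^ 2) χ₄ ε))) * √(norm2 (χ₁ - χ₃)) *
        ((ell (wave (c ^ 2) χ₁ ε) (-wave (c ^ 2) χ₃ ε) +
          ell (ε • (χ₁ - χ₃)) (wave (c ^ 2) χ₃ ε) -
          ell (ε • (χ₁ - χ₃)) (-wave (c ^ 2) χ₁ ε)) / √ε) *
        ((ell (wave (c ^ 2) χ₄ ε) (-wave (c ^ 2) χ₂ ε) +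
          ell (ε • (χ₁ - χ₃)) (wave (c ^ 2) χ₂ ε) -
          ell (ε • (χ₁ - χ₃)) (-wave (c ^ 2) χ₄ ε)) / √ε) *
        (√g * √ε * (omg g (wave (c ^ 2) χ₁ ε) + omg g (ε • (χ₁ - χ₃)) -
            omg g (wave (c ^ 2) χ₃ ε))⁻¹ +
          √g * √ε * (omg g (wave (c ^ 2) χ₄ ε) + omg g (ε • (χ₁ - χ₃)) -
            omg g (wave (c ^ 2) χ₂ ε))⁻¹)) := by
  have h24 : ε • (χ₂ - χ₄) = -(ε • (χ₁ - χ₃)) := by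
    rw [← smul_neg, show χ₂ - χ₄ = -(χ₁ - χ₃) from by
      rw [neg_sub, sub_eq_sub_iff_add_eq_add, add_comm χ₂, hχ]]
  have hell (a b : ℝ × ℝ) : ell (-a) b = ell a (-b) := by rw [← ell_neg_neg, neg_neg]
  simp only [coefII, wave_add_neg_wave, h24, hell, norm2_neg, omg_neg, neg_neg]
  rw [rpow_quarter_mul_sq (mul_nonneg (mul_nonneg (mul_nonneg (norm2_nonneg _)
      (norm2_nonneg _)) (norm2_nonneg _)) (norm2_nonneg _)) (norm2_nonneg _),
    norm2_smul hε.le, Real.sqrt_mul hε.le]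
  have hs : √ε ≠ 0 := (Real.sqrt_pos.2 hε).ne'
  conv_rhs => enter [1]; rw [← Real.mul_self_sqrt hε.le]
  field_simp

theorem coefII_isBigO {g c : ℝ} (hg : 0 < g) (hc : 0 < c) {χ₁ χ₂ χ₃ χ₄ : ℝ × ℝ}
    (hχ : χ₁ + χ₂ = χ₃ + χ₄) (hne : χ₁ ≠ χ₃) :
    (fun ε => coefII g (wave (c ^ 2) χ₁ ε) (wave (c ^ 2) χ₂ ε)
        (-wave (c ^ 2) χ₃ ε) (-wave (c ^ 2) χ₄ ε) -
      ε * (c ^ 4 * (χ₁.1 - χ₃.1) ^ 2 / (4 * Real.pi ^ 2 * norm2 (χ₁ - χ₃))))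
      =O[𝓝[>] (0 : ℝ)] fun ε => ε * √ε := by
  have hχ0 : χ₁ - χ₃ ≠ 0 := sub_ne_zero.2 hne
  have hN : 0 < √(norm2 (χ₁ - χ₃)) := Real.sqrt_pos.2 (norm2_pos hχ0)
  have hG := (((((HasLead.const (32 * Real.pi ^ 2)⁻¹).mul
    (hasJet_sqrt_sqrt_norm2 hc χ₁ χ₂ χ₃ χ₄).hasLead).mul (HasLead.const √(norm2 (χ₁ - χ₃)))).mul
    (hasLead_ell_combination hc hχ0 χ₁ χ₃)).mul (hasLead_ell_combination hc hχ0 χ₄ χ₂)).mul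
    ((hasLead_denominator hg hc hχ0 χ₁ χ₃).add (hasLead_denominator hg hc hχ0 χ₄ χ₂))
  refine IsBigO.congr' ((isBigO_refl (fun ε : ℝ => ε) _).mul hG) ?_ EventuallyEq.rfl
  filter_upwards [self_mem_nhdsWithin] with ε hε
  rw [coefII_eq hε hχ, mul_sub]
  congr 2
  rw [← Real.sq_sqrt (norm2_nonneg (χ₁ - χ₃)), Prod.fst_sub, Real.sqrt_sq hN.le]
  field_simp
  ring

/-- Pointwise form of the reduced fourth-order coefficient (Proposition 4.3). -/
theorem reduced_fourth_order_coefficient (g k₀ : ℝ) (hg : 0 < g) (hk₀ : 0 < k₀)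
    (χ₁ χ₂ χ₃ χ₄ : ℝ × ℝ) (hχ : χ₁ + χ₂ = χ₃ + χ₄) (hne : χ₁ ≠ χ₃) :
    (fun ε : ℝ =>
        (T1 ((k₀, 0) + ε • χ₁) ((k₀, 0) + ε • χ₂)
            (-((k₀, 0) + ε • χ₃)) (-((k₀, 0) + ε • χ₄))
          - (1 / 2) *
            (coefI g ((k₀, 0) + ε • χ₁) ((k₀, 0) + ε • χ₂)
                (-((k₀, 0) + ε • χ₃)) (-((k₀, 0) + ε • χ₄))
              + coefII g ((k₀, 0) + ε • χ₁) ((k₀, 0) + ε • χ₂)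
                  (-((k₀, 0) + ε • χ₃)) (-((k₀, 0) + ε • χ₄))
              + coefIII g ((k₀, 0) + ε • χ₁) ((k₀, 0) + ε • χ₂)
                  (-((k₀, 0) + ε • χ₃)) (-((k₀, 0) + ε • χ₄))))
          - (k₀ ^ 3 / (8 * Real.pi ^ 2) *
              (1 + 3 * ε / (4 * k₀) * (χ₁.1 + χ₂.1 + χ₃.1 + χ₄.1))
            - ε * (k₀ ^ 2 / (8 * Real.pi ^ 2)) * (χ₁.1 - χ₃.1) ^ 2 / norm2 (χ₁ - χ₃)))
      =O[𝓝[>] (0 : ℝ)] fun ε => ε ^ ((3 : ℝ) / 2) := by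
  obtain ⟨c, hc, rfl⟩ : ∃ c, 0 < c ∧ c ^ 2 = k₀ := ⟨√k₀, Real.sqrt_pos.2 hk₀, Real.sq_sqrt hk₀.le⟩
  have h4 : χ₄.1 = χ₁.1 + χ₂.1 - χ₃.1 := by
    have := congrArg Prod.fst hχ
    simp only [Prod.fst_add] at this
    linarith
  have hpow : (fun ε : ℝ => ε * √ε) =ᶠ[𝓝[>] (0 : ℝ)] fun ε => ε ^ ((3 : ℝ) / 2) := by
    filter_upwards [self_mem_nhdsWithin] with ε hε
    rw [show (3 : ℝ) / 2 = 1 + 1 / 2 by norm_num, Real.rpow_add hε, Real.rpow_one,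
      Real.sqrt_eq_rpow]
  have hsq : (fun ε : ℝ => ε ^ 2) =O[𝓝[>] (0 : ℝ)] fun ε => ε * √ε := by
    simpa only [pow_two] using (isBigO_refl (fun ε : ℝ => ε) _).mul isBigO_id_sqrt
  have hjet := (hasJet_T1 hc hχ).sub ((hasJet_coefI_add_coefIII hg hc hχ).const_mul (1 / 2))
  have hN : norm2 (χ₁ - χ₃) ≠ 0 := (norm2_pos (sub_ne_zero.2 hne)).ne'
  refine ((IsBigO.trans hjet hsq).sub
    ((coefII_isBigO hg hc hχ hne).const_mul_left (1 / 2))).congr' ?_ hpow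
  refine Eventually.of_forall fun ε => ?_
  simp only [wave, h4]
  field_simp
  ring
end

section
/- (Nonlocal quartic Fourier identity.) Let u : ℝ² → ℂ be a Schwartz-class function with Fourier transform û(χ) = (1/(2π)) ∫_{ℝ²} u(X) e^{−i χ·X} dX, and for χ = (λ, μ) ∈ ℝ² write λ(χ) = λ for its first component. Then ∫_{ℝ²}∫_{ℝ²}∫_{ℝ²} ( (λ(χ₁) − λ(χ₃))² / ‖χ₁ − χ₃‖ ) û(χ₁) û(χ₂) conj(û(χ₃)) conj(û(χ₁+χ₂−χ₃)) dχ₁ dχ₂ dχ₃ = 4π² ∫_{ℝ²} ( ξ₁² / ‖ξ‖ ) | F(|u|²)(ξ) |² dξ, where ξ₁ denotes the first component of ξ and F(|u|²) is the Fourier transform of the function X ↦ |u(X)|² with the same convention. -/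
open MeasureTheory

/-- Fourier transform on ℝ² with the convention û(χ) = (1/(2π)) ∫ u(X) e^{−iχ·X} dX. -/
noncomputable def ft (u : ℝ × ℝ → ℂ) (χ : ℝ × ℝ) : ℂ :=
  (1 / (2 * Real.pi) : ℝ) * ∫ X : ℝ × ℝ, u X * Complex.exp (-Complex.I * (dot χ X : ℂ))

open scoped FourierTransform SchwartzMap

theorem ft_eq_fourier (u : ℝ × ℝ → ℂ) (y : WithLp 2 (ℝ × ℝ)) :
    ft u (2 * Real.pi * y.fst, 2 * Real.pi * y.snd) =
      (1 / (2 * Real.pi) : ℝ) * 𝓕 (fun x : WithLp 2 (ℝ × ℝ) => u (WithLp.ofLp x)) y := by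
  rw [ft, Real.fourier_eq']
  congr 1
  rw [← (WithLp.volume_preserving_ofLp ℝ ℝ).integral_comp
    (MeasurableEquiv.toLp 2 (ℝ × ℝ)).symm.measurableEmbedding]
  refine integral_congr_ae (.of_forall fun x => ?_)
  simp only [smul_eq_mul, dot, WithLp.prod_inner_apply]
  rw [mul_comm]
  congr 2
  simp
  ring

theorem exists_schwartzMap_eq_ft (u : 𝓢(ℝ × ℝ, ℂ)) :
    ∃ v : 𝓢(ℝ × ℝ, ℂ), ∀ χ, v χ = ft u χ := by
  let P := WithLp.prodContinuousLinearEquiv 2 ℝ ℝ ℝ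
  have hc : (2 * Real.pi)⁻¹ ≠ 0 := by positivity
  let S := (LinearEquiv.smulOfNeZero ℝ (ℝ × ℝ) (2 * Real.pi)⁻¹ hc).toContinuousLinearEquiv
  refine ⟨((1 / (2 * Real.pi) : ℝ) : ℂ) •
    SchwartzMap.compCLMOfContinuousLinearEquiv ℂ (S.trans P.symm)
      (𝓕 (SchwartzMap.compCLMOfContinuousLinearEquiv ℂ P u)), fun χ => ?_⟩
  have h := ft_eq_fourier u (P.symm (S χ))
  have e : ((2 * Real.pi * (P.symm (S χ)).fst, 2 * Real.pi * (P.symm (S χ)).snd) : ℝ × ℝ) = χ := by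
    ext <;> simp [P, S] <;> field_simp
  rw [e] at h
  rw [h]
  rfl

theorem ft_inversion (u : 𝓢(ℝ × ℝ, ℂ)) (X : ℝ × ℝ) :
    (1 / (2 * Real.pi) : ℝ) * ∫ χ, ft u χ * Complex.exp (Complex.I * (dot χ X : ℂ)) = u X := by
  let P := WithLp.prodContinuousLinearEquiv 2 ℝ ℝ ℝ
  let U : 𝓢(WithLp 2 (ℝ × ℝ), ℂ) := SchwartzMap.compCLMOfContinuousLinearEquiv ℂ P u
  have h : 𝓕⁻ (𝓕 U) (P.symm X) = U (P.symm X) := by rw [FourierTransform.fourierInv_fourier_eq]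
  have hU : U (P.symm X) = u X := by simp [U]
  rw [hU, SchwartzMap.fourierInv_coe, Real.fourierInv_eq'] at h
  rw [← h]
  have hs := Measure.integral_comp_smul_of_nonneg (volume : Measure (ℝ × ℝ))
    (fun χ => ft u χ * Complex.exp (Complex.I * (dot χ X : ℂ))) (2 * Real.pi)
    (hR := by positivity)
  rw [Module.finrank_prod, Module.finrank_self, ← (WithLp.volume_preserving_ofLp ℝ ℝ).integral_comp
    (MeasurableEquiv.toLp 2 (ℝ × ℝ)).symm.measurableEmbedding] at hs
  have key : ∀ y : WithLp 2 (ℝ × ℝ),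
      ft u ((2 * Real.pi) • WithLp.ofLp y) *
        Complex.exp (Complex.I * (dot ((2 * Real.pi) • WithLp.ofLp y) X : ℂ)) =
      ((1 / (2 * Real.pi) : ℝ) : ℂ) *
        (Complex.exp (((2 * Real.pi * inner ℝ y (P.symm X) : ℝ) : ℂ) * Complex.I) • (𝓕 U) y) := by
    intro y
    have h1 : ft u ((2 * Real.pi) • WithLp.ofLp y) = _ := ft_eq_fourier u y
    rw [h1, mul_assoc, smul_eq_mul, mul_comm (Complex.exp _)]
    congr 2
    simp [dot, WithLp.prod_inner_apply, P]
    ring_nf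
  simp_rw [key] at hs
  rw [integral_const_mul] at hs
  rw [Complex.real_smul] at hs
  set I := ∫ χ, ft u χ * Complex.exp (Complex.I * (dot χ X : ℂ))
  set J := ∫ y : WithLp 2 (ℝ × ℝ),
    Complex.exp (((2 * Real.pi * inner ℝ y (P.symm X) : ℝ) : ℂ) * Complex.I) • (𝓕 U) y
  push_cast at hs ⊢
  field_simp at hs ⊢
  linear_combination -hs

theorem integral_ft_mul_conj {f h : ℝ × ℝ → ℂ} (hf : Integrable f) (hh : Integrable h) :
    ∫ η, ft f η * (starRingEnd ℂ) (h η) =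
      ∫ X, f X * (starRingEnd ℂ)
        ((1 / (2 * Real.pi) : ℝ) * ∫ η, h η * Complex.exp (Complex.I * (dot η X : ℂ))) := by
  have hi : Integrable (Function.uncurry fun η X : ℝ × ℝ =>
      (1 / (2 * Real.pi) : ℝ) * (f X * Complex.exp (-Complex.I * (dot η X : ℂ)) *
        (starRingEnd ℂ) (h η))) := by
    have h0 := ((LinearIsometryEquiv.integrable_comp_iff (Complex.conjLIE)).2 hh).mul_prod hf
    refine (h0.norm.const_mul (1 / (2 * Real.pi))).mono' ?_ (.of_forall fun p => ?_)
    · have e1 : Continuous fun p : (ℝ × ℝ) × (ℝ × ℝ) =>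
          Complex.exp (-Complex.I * (dot p.1 p.2 : ℂ)) := by unfold dot; fun_prop
      refine AEStronglyMeasurable.const_mul ?_ _
      exact (hf.aestronglyMeasurable.comp_snd.mul e1.aestronglyMeasurable).mul
        (Complex.continuous_conj.comp_aestronglyMeasurable hh.aestronglyMeasurable.comp_fst)
    · have : ‖Complex.exp (-Complex.I * (dot p.1 p.2 : ℂ))‖ = 1 := by
        simp [Complex.norm_exp]
      simp only [Function.uncurry, norm_mul, this]
      simp [abs_of_pos Real.pi_pos]
      apply le_of_eq; ring
  calc _ = ∫ η, ∫ X, (1 / (2 * Real.pi) : ℝ) * (f X * Complex.exp (-Complex.I * (dot η X : ℂ)) *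
        (starRingEnd ℂ) (h η)) := by
        refine integral_congr_ae (.of_forall fun η => ?_)
        simp only
        rw [integral_const_mul, integral_mul_const, ft, mul_assoc]
    _ = _ := by
        rw [integral_integral_swap hi]
        refine integral_congr_ae (.of_forall fun X => ?_)
        simp only
        rw [integral_const_mul, map_mul, ← integral_conj, Complex.conj_ofReal, mul_left_comm]
        congr 1
        rw [← integral_const_mul]
        refine integral_congr_ae (.of_forall fun η => ?_)
        simp only
        rw [map_mul, ← Complex.exp_conj]
        simp
        ring

theorem ft_mul_exp (u : ℝ × ℝ → ℂ) (ξ η : ℝ × ℝ) :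
    ft (fun X => u X * Complex.exp (-Complex.I * (dot ξ X : ℂ))) η = ft u (η + ξ) := by
  unfold ft
  congr with X
  rw [mul_assoc, ← Complex.exp_add]
  congr 2
  simp [dot]
  ring

theorem integral_ft_add_mul_conj_ft (u : 𝓢(ℝ × ℝ, ℂ)) (ξ : ℝ × ℝ) :
    ∫ η, ft u (η + ξ) * (starRingEnd ℂ) (ft u η) =
      (2 * Real.pi : ℝ) * ft (fun X => ((‖u X‖ ^ 2 : ℝ) : ℂ)) ξ := by
  obtain ⟨v, hv⟩ := exists_schwartzMap_eq_ft u
  have hvi : Integrable (ft u) := by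
    have := v.integrable (μ := volume)
    rwa [show (v : ℝ × ℝ → ℂ) = ft u from funext hv] at this
  have hi : Integrable fun X => u X * Complex.exp (-Complex.I * (dot ξ X : ℂ)) := by
    refine (u.integrable (μ := volume)).norm.mono' ?_ (.of_forall fun X => ?_)
    · exact (u.continuous.mul (by unfold dot; fun_prop)).aestronglyMeasurable
    · simp [Complex.norm_exp]
  have h := integral_ft_mul_conj hi hvi
  simp_rw [ft_mul_exp, ft_inversion] at h
  rw [h, ft, ← mul_assoc, ← Complex.ofReal_mul, mul_one_div_cancel (by positivity),
    Complex.ofReal_one, one_mul]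
  congr with X
  rw [mul_right_comm, Complex.mul_conj']
  push_cast
  rfl

theorem integrable_one_add_norm_mul (v : 𝓢(ℝ × ℝ, ℂ)) :
    Integrable fun x => (1 + ‖x‖) * ‖v x‖ := by
  have h := (v.integrable_pow_mul volume 0).add (v.integrable_pow_mul volume 1)
  refine h.congr (.of_forall fun x => ?_)
  simp [add_mul]

theorem norm_le_one_add_norm_mul_one_add_norm_sub {E : Type*} [SeminormedAddCommGroup E] (x ξ : E) :
    ‖ξ‖ ≤ (1 + ‖x‖) * (1 + ‖x - ξ‖) := by
  have h : ‖ξ‖ ≤ ‖x‖ + ‖x - ξ‖ := by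
    simpa using norm_sub_le x (x - ξ)
  nlinarith [norm_nonneg x, norm_nonneg (x - ξ), mul_nonneg (norm_nonneg x) (norm_nonneg (x - ξ))]

theorem integral_multiplier_mul_eq_integral_autocorrelation (v : 𝓢(ℝ × ℝ, ℂ)) {m : ℝ × ℝ → ℝ}
    (hm : Measurable m) (hm' : ∀ ξ, |m ξ| ≤ ‖ξ‖) :
    (∫ χ₁ : ℝ × ℝ, ∫ χ₂ : ℝ × ℝ, ∫ χ₃ : ℝ × ℝ,
        (m (χ₁ - χ₃) : ℂ) * v χ₁ * v χ₂ * (starRingEnd ℂ) (v χ₃) *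
          (starRingEnd ℂ) (v (χ₁ + χ₂ - χ₃))) =
      ∫ ξ, (m ξ : ℂ) * (‖∫ η, v (η + ξ) * (starRingEnd ℂ) (v η)‖ ^ 2 : ℝ) := by
  set V : ℝ × ℝ → ℂ := fun ξ => ∫ η, v (η + ξ) * (starRingEnd ℂ) (v η) with hV
  obtain ⟨C, -, hC⟩ := v.decay 0 0
  replace hC : ∀ x, ‖v x‖ ≤ C := fun x => by simpa using hC x
  have hC0 : 0 ≤ C := (norm_nonneg _).trans (hC 0)
  have hv := v.continuous
  have hvi := (v.integrable (μ := volume)).norm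
  have hg := integrable_one_add_norm_mul v
  have hVm : StronglyMeasurable V := by
    refine StronglyMeasurable.integral_prod_right
      (f := fun ξ η => v (η + ξ) * (starRingEnd ℂ) (v η)) (Continuous.stronglyMeasurable ?_)
    unfold Function.uncurry
    exact (hv.comp (by fun_prop)).mul (Complex.continuous_conj.comp (hv.comp continuous_snd))
  have hVb : ∀ ξ, ‖V ξ‖ ≤ C * ∫ η, ‖v η‖ := by
    intro ξ
    rw [← integral_const_mul]
    refine norm_integral_le_of_norm_le (hvi.const_mul C) (.of_forall fun η => ?_)
    simp only [norm_mul, RCLike.norm_conj]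
    exact mul_le_mul_of_nonneg_right (hC _) (norm_nonneg _)
  have hVconj : ∀ ξ, ∫ χ, v χ * (starRingEnd ℂ) (v (χ + ξ)) = (starRingEnd ℂ) (V ξ) := by
    intro ξ
    rw [hV, ← integral_conj]
    simp [mul_comm]
  have hVshift : ∀ ξ, ∫ χ, v χ * (starRingEnd ℂ) (v (χ - ξ)) = V ξ := by
    intro ξ
    rw [hV, ← integral_add_right_eq_self _ ξ]
    simp
  have hbound : ∀ x ξ, |m ξ| * ‖v x‖ * ‖v (x - ξ)‖ ≤
      ((1 + ‖x‖) * ‖v x‖) * ((1 + ‖x - ξ‖) * ‖v (x - ξ)‖) := by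
    intro x ξ
    have h := (hm' ξ).trans (norm_le_one_add_norm_mul_one_add_norm_sub x ξ)
    calc |m ξ| * ‖v x‖ * ‖v (x - ξ)‖
        ≤ ((1 + ‖x‖) * (1 + ‖x - ξ‖)) * ‖v x‖ * ‖v (x - ξ)‖ := by gcongr
      _ = _ := by ring
  have hmc : Measurable fun ξ => (m ξ : ℂ) := Complex.measurable_ofReal.comp hm
  have hconj : Measurable (starRingEnd ℂ) := Complex.continuous_conj.measurable
  have hvm := hv.measurable
  have inner : ∀ χ₁, (∫ χ₂ : ℝ × ℝ, ∫ χ₃ : ℝ × ℝ,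
        (m (χ₁ - χ₃) : ℂ) * v χ₁ * v χ₂ * (starRingEnd ℂ) (v χ₃) *
          (starRingEnd ℂ) (v (χ₁ + χ₂ - χ₃))) =
      ∫ ξ, (m ξ : ℂ) * v χ₁ * (starRingEnd ℂ) (v (χ₁ - ξ)) * (starRingEnd ℂ) (V ξ) := by
    intro χ₁
    have hi : Integrable (Function.uncurry fun χ₂ ξ : ℝ × ℝ =>
        ((m ξ : ℂ) * v χ₁ * (starRingEnd ℂ) (v (χ₁ - ξ))) *
          (v χ₂ * (starRingEnd ℂ) (v (χ₂ + ξ)))) := by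
      refine ((hvi.mul_prod (hg.comp_sub_left χ₁)).const_mul
        (C * ((1 + ‖χ₁‖) * ‖v χ₁‖))).mono' ?_ (.of_forall fun p => ?_)
      · unfold Function.uncurry
        exact Measurable.aestronglyMeasurable (by fun_prop)
      · simp only [Function.uncurry, norm_mul, RCLike.norm_conj, Complex.norm_real, Real.norm_eq_abs]
        calc _ ≤ (((1 + ‖χ₁‖) * ‖v χ₁‖) * ((1 + ‖χ₁ - p.2‖) * ‖v (χ₁ - p.2)‖)) *
              (‖v p.1‖ * C) := by
              refine mul_le_mul (hbound _ _) ?_ (by positivity) (by positivity)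
              exact mul_le_mul_of_nonneg_left (hC _) (norm_nonneg _)
          _ = _ := by ring
    calc _ = ∫ χ₂ : ℝ × ℝ, ∫ ξ : ℝ × ℝ, ((m ξ : ℂ) * v χ₁ * (starRingEnd ℂ) (v (χ₁ - ξ))) *
          (v χ₂ * (starRingEnd ℂ) (v (χ₂ + ξ))) := by
          refine integral_congr_ae (.of_forall fun χ₂ => ?_)
          simp only
          rw [← integral_sub_left_eq_self _ volume χ₁]
          refine integral_congr_ae (.of_forall fun ξ => ?_)
          simp only [sub_sub_cancel]
          rw [show χ₁ + χ₂ - (χ₁ - ξ) = χ₂ + ξ by abel]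
          ring
      _ = _ := by
          rw [integral_integral_swap hi]
          refine integral_congr_ae (.of_forall fun ξ => ?_)
          simp only
          rw [integral_const_mul, hVconj]
  have hi : Integrable (Function.uncurry fun χ₁ ξ : ℝ × ℝ =>
      (m ξ : ℂ) * v χ₁ * (starRingEnd ℂ) (v (χ₁ - ξ)) * (starRingEnd ℂ) (V ξ)) := by
    have h0 := hg.convolution_integrand (ContinuousLinearMap.mul ℝ ℝ) hg.comp_neg
    refine (h0.swap.const_mul (C * ∫ η, ‖v η‖)).mono' ?_ (.of_forall fun p => ?_)
    · have := hVm.measurable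
      unfold Function.uncurry
      exact Measurable.aestronglyMeasurable (by fun_prop)
    · simp only [Function.uncurry, norm_mul, RCLike.norm_conj, Complex.norm_real, Real.norm_eq_abs,
        Function.comp, Prod.fst_swap, Prod.snd_swap, ContinuousLinearMap.mul_apply', neg_sub]
      rw [mul_comm (C * _)]
      exact mul_le_mul (hbound _ _) (hVb _) (norm_nonneg _) (by positivity)
  simp_rw [inner]
  rw [integral_integral_swap hi]
  refine integral_congr_ae (.of_forall fun ξ => ?_)
  calc _ = ∫ χ, ((m ξ : ℂ) * (starRingEnd ℂ) (V ξ)) * (v χ * (starRingEnd ℂ) (v (χ - ξ))) := by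
        refine integral_congr_ae (.of_forall fun χ => ?_)
        simp only
        ring
    _ = _ := by
        rw [integral_const_mul, hVshift, mul_assoc, Complex.conj_mul']
        push_cast
        rfl

theorem abs_sq_fst_div_norm2_le (ξ : ℝ × ℝ) : |ξ.1 ^ 2 / norm2 ξ| ≤ ‖ξ‖ := by
  have h0 : 0 ≤ norm2 ξ := Real.sqrt_nonneg _
  have h1 : |ξ.1| ≤ norm2 ξ := Real.abs_le_sqrt (by nlinarith [sq_nonneg ξ.2])
  rw [abs_of_nonneg (by positivity)]
  refine le_trans (div_le_of_le_mul₀ h0 (abs_nonneg _) ?_) (norm_fst_le ξ)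
  rw [← sq_abs, sq]
  exact mul_le_mul_of_nonneg_left h1 (abs_nonneg _)

/-- Nonlocal quartic Fourier identity encoding the wave-induced mean flow term. -/
theorem nonlocal_quartic_identity (u : SchwartzMap (ℝ × ℝ) ℂ) :
    (∫ χ₁ : ℝ × ℝ, ∫ χ₂ : ℝ × ℝ, ∫ χ₃ : ℝ × ℝ,
        (((χ₁.1 - χ₃.1) ^ 2 / norm2 (χ₁ - χ₃) : ℝ) : ℂ) *
          ft (⇑u) χ₁ * ft (⇑u) χ₂ * (starRingEnd ℂ) (ft (⇑u) χ₃) *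
          (starRingEnd ℂ) (ft (⇑u) (χ₁ + χ₂ - χ₃)))
      = ((4 * Real.pi ^ 2 *
          ∫ ξ : ℝ × ℝ, ξ.1 ^ 2 / norm2 ξ *
            ‖ft (fun X => ((‖u X‖ ^ 2 : ℝ) : ℂ)) ξ‖ ^ 2 : ℝ) : ℂ) := by
  obtain ⟨v, hv⟩ := exists_schwartzMap_eq_ft u
  have hm : Measurable fun ξ : ℝ × ℝ => ξ.1 ^ 2 / norm2 ξ := by
    unfold norm2
    fun_prop
  have h := integral_multiplier_mul_eq_integral_autocorrelation v hm abs_sq_fst_div_norm2_le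
  simp_rw [hv, integral_ft_add_mul_conj_ft] at h
  refine Eq.trans h ?_
  rw [← integral_const_mul, ← integral_complex_ofReal]
  refine integral_congr_ae (.of_forall fun ξ => ?_)
  simp only [norm_mul, Complex.norm_real, Real.norm_of_nonneg Real.two_pi_pos.le]
  push_cast
  ring
end
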